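/- arXiv:2406.19510 — 3 statements merged into one kernel-verified Lean document; each statement's English description precedes it below -/
import Mathlib

section
/- Let f : [−1,1] → ℝ be such that f′ is absolutely continuous on [−1,1] and f′(−1) = f′(1) = 0. Then lim_{ε→0} ε⁻² 𝓛_ε f(x) = (1/6) f″(x) for Lebesgue-almost every x ∈ [−1,1]. If moreover f″ is continuous on [−1,1], then this limit holds at every x ∈ [−1,1]. -/
open MeasureTheory Set Filter Topology

theorem aux_taylor (f f' : ℝ → ℝ) (x c : ℝ) (hx : x ∈ Icc (-1 : ℝ) 1)
    (hf' : ∀ x ∈ Icc (-1 : ℝ) 1, HasDerivWithinAt f (f' x) (Icc (-1 : ℝ) 1) x)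
    (hd : HasDerivWithinAt f' c (Icc (-1 : ℝ) 1) x) (η : ℝ) (hη : 0 < η) :
    ∃ δ > 0, ∀ y ∈ Icc (-1 : ℝ) 1, |y - x| < δ →
      |f y - f x - (f' x * (y - x) + c / 2 * (y - x) ^ 2)| ≤ η * (y - x) ^ 2 := by
  have h1 := (hasDerivWithinAt_iff_isLittleO.1 hd).def hη
  rw [eventually_nhdsWithin_iff, Metric.eventually_nhds_iff] at h1
  obtain ⟨δ, hδ, h⟩ := h1
  refine ⟨δ, hδ, fun y hy hyd => ?_⟩
  have hsub : uIcc x y ⊆ Icc (-1 : ℝ) 1 := by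
    rw [← uIcc_of_le (by norm_num : (-1 : ℝ) ≤ 1)] at hx hy ⊢
    exact uIcc_subset_uIcc hx hy
  have key := Convex.norm_image_sub_le_of_norm_hasDerivWithin_le (s := uIcc x y)
    (f := fun z => f z - f x - (f' x * (z - x) + c / 2 * (z - x) ^ 2))
    (f' := fun z => f' z - f' x - (z - x) * c) (C := η * |y - x|) (x := x) (y := y)
    (fun z hz => by
      have a1 := (hf' z (hsub hz)).mono hsub
      have a2 : HasDerivAt (fun z => f' x * (z - x) + c / 2 * (z - x) ^ 2)
          (f' x + (z - x) * c) z := by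
        have b1 : HasDerivAt (fun z : ℝ => z - x) 1 z := (hasDerivAt_id z).sub_const x
        have := (b1.const_mul (f' x)).add ((b1.pow 2).const_mul (c / 2))
        refine this.congr_deriv ?_
        simp; ring
      refine ((a1.sub_const (f x)).sub a2.hasDerivWithinAt).congr_deriv ?_
      ring)
    (fun z hz => by
      have hzx : |z - x| ≤ |y - x| := abs_sub_left_of_mem_uIcc hz
      have := h (y := z) (by rw [Real.dist_eq]; exact hzx.trans_lt hyd) (hsub hz)
      simp only [smul_eq_mul, Real.norm_eq_abs] at this ⊢
      exact this.trans (by gcongr))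
    (convex_uIcc x y) left_mem_uIcc right_mem_uIcc
  simp only [Real.norm_eq_abs, sub_self] at key
  have e : η * |y - x| * |y - x| = η * (y - x) ^ 2 := by
    rw [mul_assoc, ← sq, sq_abs]
  rw [e] at key
  simpa using key

theorem aux_main (f f' : ℝ → ℝ) (x c : ℝ) (hx : x ∈ Icc (-1 : ℝ) 1)
    (hf' : ∀ x ∈ Icc (-1 : ℝ) 1, HasDerivWithinAt f (f' x) (Icc (-1 : ℝ) 1) x)
    (hbc1 : f' (-1) = 0) (hbc2 : f' 1 = 0)
    (hd : HasDerivWithinAt f' c (Icc (-1 : ℝ) 1) x) :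
    Tendsto (fun ε : ℝ =>
          (ε ^ 2)⁻¹ * ((volume (Ioo (x - ε) (x + ε) ∩ Icc (-1 : ℝ) 1)).toReal⁻¹ *
            ∫ y in Ioo (x - ε) (x + ε) ∩ Icc (-1 : ℝ) 1, (f y - f x)))
        (𝓝[>] 0) (𝓝 (c / 6)) := by
  rw [Metric.tendsto_nhds]
  intro η hη
  obtain ⟨δ, hδ, hT⟩ := aux_taylor f f' x c hx hf' hd (η / 2) (half_pos hη)
  obtain ⟨ρ, hρ, hgeo⟩ : ∃ ρ > 0, ∀ ε : ℝ, 0 < ε → ε < ρ →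
      (max (x - ε) (-1) < min (x + ε) 1) ∧
      f' x * ((min (x + ε) 1 - x) ^ 2 - (max (x - ε) (-1) - x) ^ 2) / 2
        + c / 6 * ((min (x + ε) 1 - x) ^ 3 - (max (x - ε) (-1) - x) ^ 3)
        = c / 6 * ε ^ 2 * (min (x + ε) 1 - max (x - ε) (-1)) := by
    rcases eq_or_lt_of_le hx.1 with h1 | h1
    · refine ⟨1, one_pos, fun ε h0 hε => ?_⟩
      rw [← h1, min_eq_left (by linarith), max_eq_right (by linarith), hbc1]
      exact ⟨by linarith, by ring⟩
    rcases eq_or_lt_of_le hx.2 with h2 | h2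
    · refine ⟨1, one_pos, fun ε h0 hε => ?_⟩
      rw [h2, min_eq_right (by linarith), max_eq_left (by linarith), hbc2]
      exact ⟨by linarith, by ring⟩
    · refine ⟨min (1 - x) (x + 1), lt_min (by linarith) (by linarith), fun ε h0 hε => ?_⟩
      have := hε.trans_le (min_le_left _ _)
      have := hε.trans_le (min_le_right _ _)
      rw [min_eq_left (by linarith), max_eq_left (by linarith)]
      exact ⟨by linarith, by ring⟩
  filter_upwards [Ioo_mem_nhdsGT (lt_min hδ hρ)] with ε hε
  have hε0 : 0 < ε := hε.1
  have hεδ : ε < δ := hε.2.trans_le (min_le_left _ _)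
  obtain ⟨hab, hpoly⟩ := hgeo ε hε0 (hε.2.trans_le (min_le_right _ _))
  have ha1 : x - ε ≤ max (x - ε) (-1) := le_max_left _ _
  have ha2 : -1 ≤ max (x - ε) (-1) := le_max_right _ _
  have hb1 : min (x + ε) 1 ≤ x + ε := min_le_left _ _
  have hb2 : min (x + ε) 1 ≤ 1 := min_le_right _ _
  have hS : (Ioo (x - ε) (x + ε) ∩ Icc (-1 : ℝ) 1 : Set ℝ)
      =ᵐ[volume] Ioc (max (x - ε) (-1)) (min (x + ε) 1) := by
    have s1 : Ioo (max (x - ε) (-1)) (min (x + ε) 1) ⊆ Ioo (x - ε) (x + ε) ∩ Icc (-1 : ℝ) 1 :=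
      fun y hy => ⟨⟨by linarith [hy.1], by linarith [hy.2]⟩, by linarith [hy.1], by linarith [hy.2]⟩
    have s2 : Ioo (x - ε) (x + ε) ∩ Icc (-1 : ℝ) 1 ⊆ Icc (max (x - ε) (-1)) (min (x + ε) 1) :=
      fun y hy => ⟨max_le hy.1.1.le hy.2.1, le_min hy.1.2.le hy.2.2⟩
    refine EventuallyLE.antisymm ?_ ?_
    · exact s2.eventuallyLE.trans Ioc_ae_eq_Icc.symm.le
    · exact Ioo_ae_eq_Ioc.symm.le.trans s1.eventuallyLE
  rw [measure_congr hS, setIntegral_congr_set hS, ← intervalIntegral.integral_of_le hab.le,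
    Real.volume_Ioc, ENNReal.toReal_ofReal (by linarith)]
  generalize max (x - ε) (-1) = a at *
  generalize min (x + ε) 1 = b at *
  have hsub : uIcc a b ⊆ Icc (-1 : ℝ) 1 := by
    rw [uIcc_of_le hab.le]; exact Icc_subset_Icc ha2 hb2
  have hfc : ContinuousOn f (uIcc a b) := fun z hz =>
    ((hf' z (hsub hz)).continuousWithinAt).mono hsub
  have i1 : IntervalIntegrable (fun y => f y - f x) volume a b :=
    (hfc.sub continuousOn_const).intervalIntegrable
  have i2 : IntervalIntegrable (fun y => f' x * (y - x) + c / 2 * (y - x) ^ 2) volume a b :=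
    Continuous.intervalIntegrable (by fun_prop) _ _
  have e2 : ∫ y in a..b, (f' x * (y - x) + c / 2 * (y - x) ^ 2) = c / 6 * ε ^ 2 * (b - a) := by
    rw [← hpoly, intervalIntegral.integral_add (Continuous.intervalIntegrable (by fun_prop) _ _)
      (Continuous.intervalIntegrable (by fun_prop) _ _),
      intervalIntegral.integral_const_mul, intervalIntegral.integral_const_mul,
      intervalIntegral.integral_comp_sub_right (fun y => y),
      intervalIntegral.integral_comp_sub_right (fun y => y ^ 2), integral_id, integral_pow]
    norm_num
    ring
  have e3 := intervalIntegral.norm_integral_le_of_norm_le_const (a := a) (b := b)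
    (f := fun y => f y - f x - (f' x * (y - x) + c / 2 * (y - x) ^ 2)) (C := η / 2 * ε ^ 2)
    (fun y hy => by
      rw [uIoc_of_le hab.le] at hy
      have hyx : |y - x| ≤ ε := abs_le.2 ⟨by linarith [hy.1], by linarith [hy.2]⟩
      refine (hT y ⟨by linarith [hy.1], by linarith [hy.2]⟩ (by linarith)).trans ?_
      rw [← sq_abs (y - x)]
      gcongr)
  rw [intervalIntegral.integral_sub i1 i2, e2, abs_of_pos (sub_pos.2 hab)] at e3
  generalize (∫ y in a..b, (f y - f x)) = I at *
  have hba : 0 < b - a := sub_pos.2 hab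
  have hp : 0 < ε ^ 2 * (b - a) := by positivity
  rw [Real.dist_eq]
  have e4 : (ε ^ 2)⁻¹ * ((b - a)⁻¹ * I) - c / 6
      = (I - c / 6 * ε ^ 2 * (b - a)) / (ε ^ 2 * (b - a)) := by
    have := hba.ne'
    have := hε0.ne'
    field_simp
  rw [e4, abs_div, abs_of_pos hp, div_lt_iff₀ hp]
  rw [Real.norm_eq_abs] at e3
  nlinarith

/-- If `f'` is absolutely continuous on `[-1,1]` (with a.e. derivative `f''` and the
fundamental theorem of calculus holding) and `f'(-1) = f'(1) = 0`, then
`ε⁻² 𝓛_ε f(x) → f''(x)/6` at a.e. `x ∈ [-1,1]`, and at every `x` if `f''` is continuous. -/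
theorem stmt3
    (f f' f'' : ℝ → ℝ)
    (hf' : ∀ x ∈ Icc (-1 : ℝ) 1, HasDerivWithinAt f (f' x) (Icc (-1 : ℝ) 1) x)
    (hf''int : IntegrableOn f'' (Icc (-1 : ℝ) 1) volume)
    (hFTC : ∀ a ∈ Icc (-1 : ℝ) 1, ∀ b ∈ Icc (-1 : ℝ) 1,
      f' b - f' a = ∫ t in a..b, f'' t)
    (hbc1 : f' (-1) = 0) (hbc2 : f' 1 = 0) :
    (∀ᵐ x ∂(volume.restrict (Icc (-1 : ℝ) 1)),
      Tendsto (fun ε : ℝ =>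
          (ε ^ 2)⁻¹ * ((volume (Ioo (x - ε) (x + ε) ∩ Icc (-1 : ℝ) 1)).toReal⁻¹ *
            ∫ y in Ioo (x - ε) (x + ε) ∩ Icc (-1 : ℝ) 1, (f y - f x)))
        (𝓝[>] 0) (𝓝 (f'' x / 6))) ∧
    (ContinuousOn f'' (Icc (-1 : ℝ) 1) →
      ∀ x ∈ Icc (-1 : ℝ) 1,
        Tendsto (fun ε : ℝ =>
            (ε ^ 2)⁻¹ * ((volume (Ioo (x - ε) (x + ε) ∩ Icc (-1 : ℝ) 1)).toReal⁻¹ *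
              ∫ y in Ioo (x - ε) (x + ε) ∩ Icc (-1 : ℝ) 1, (f y - f x)))
          (𝓝[>] 0) (𝓝 (f'' x / 6))) := by
  have hII : IntervalIntegrable f'' volume (-1) 1 :=
    (intervalIntegrable_iff_integrableOn_Icc_of_le (by norm_num)).2 hf''int
  have h1 : (-1 : ℝ) ∈ Icc (-1 : ℝ) 1 := by norm_num
  have heq : ∀ y ∈ Icc (-1 : ℝ) 1, f' y = ∫ t in (-1 : ℝ)..y, f'' t := fun y hy => by
    rw [← hFTC _ h1 y hy, hbc1, sub_zero]
  constructor
  · rw [ae_restrict_iff' measurableSet_Icc]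
    filter_upwards [hII.ae_hasDerivAt_integral] with x hxd hx
    rw [uIcc_of_le (by norm_num)] at hxd
    exact aux_main f f' x _ hx hf' hbc1 hbc2
      ((hxd hx (-1) h1).hasDerivWithinAt.congr heq (heq x hx))
  · intro hc x hx
    have hle : (-1 : ℝ) ≤ 1 := by norm_num
    have hF : Continuous (IccExtend hle ((Icc (-1 : ℝ) 1).restrict f'')) :=
      (continuousOn_iff_continuous_restrict.1 hc).Icc_extend'
    have hFe : ∀ y ∈ Icc (-1 : ℝ) 1, IccExtend hle ((Icc (-1 : ℝ) 1).restrict f'') y = f'' y :=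
      fun y hy => IccExtend_of_mem hle _ hy
    have heq2 : ∀ y ∈ Icc (-1 : ℝ) 1,
        f' y = ∫ t in (-1 : ℝ)..y, IccExtend hle ((Icc (-1 : ℝ) 1).restrict f'') t := by
      intro y hy
      rw [heq y hy]
      refine intervalIntegral.integral_congr fun t ht => ?_
      rw [uIcc_of_le hy.1] at ht
      exact (hFe t ⟨ht.1, ht.2.trans hy.2⟩).symm
    have hd := (hF.integral_hasStrictDerivAt (-1) x).hasDerivAt
    rw [hFe x hx] at hd
    exact aux_main f f' x _ hx hf' hbc1 hbc2 (hd.hasDerivWithinAt.congr heq2 (heq2 x hx))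
end

section
/- Let k : ℝ → [0,∞) be an even integrable function supported in [−1,1] with ∫ k(s) ds = 1, and set M = (1/2)∫_{−1}^{1} k(y) y² dy. For x ∈ [−1,1] define K_ε(x,y) = k(ε⁻¹|x−y|) 𝟙_{[−1,1]}(y) / ∫_{−1}^{1} k(ε⁻¹|x−z|) dz and 𝓛_{K,ε} f(x) = ∫ (f(y) − f(x)) K_ε(x,y) dy. If f : [−1,1] → ℝ has continuous second derivative and x ∈ (−1,1), then ε⁻² 𝓛_{K,ε} f(x) → M f″(x) as ε → 0; if moreover f′(−1) = f′(1) = 0, this convergence also holds at x = −1 and x = 1. -/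
open MeasureTheory Set Filter Topology intervalIntegral


lemma aux_peano (f f' f'' : ℝ → ℝ)
    (hf' : ∀ x ∈ Icc (-1 : ℝ) 1, HasDerivWithinAt f (f' x) (Icc (-1 : ℝ) 1) x)
    (hf'' : ∀ x ∈ Icc (-1 : ℝ) 1, HasDerivWithinAt f' (f'' x) (Icc (-1 : ℝ) 1) x)
    (x : ℝ) (hx : x ∈ Icc (-1 : ℝ) 1) (η : ℝ) (hη : 0 < η) :
    ∃ δ > 0, ∀ y ∈ Icc (-1 : ℝ) 1, |y - x| < δ →
      |f y - f x - f' x * (y - x) - f'' x / 2 * (y - x) ^ 2| ≤ η * (y - x) ^ 2 := by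
  have h1 := (hasDerivWithinAt_iff_isLittleO.1 (hf'' x hx)).bound hη
  rw [eventually_nhdsWithin_iff, Metric.eventually_nhds_iff] at h1
  obtain ⟨δ, hδ, h1⟩ := h1
  refine ⟨δ, hδ, fun y hy hyx => ?_⟩
  have hconv : Convex ℝ (Icc (-1 : ℝ) 1 ∩ Metric.closedBall x |y - x|) :=
    (convex_Icc _ _).inter (convex_closedBall _ _)
  have key := hconv.norm_image_sub_le_of_norm_hasDerivWithin_le
    (f := fun z => f z - f' x * (z - x) - f'' x / 2 * (z - x) ^ 2)
    (f' := fun z => f' z - f' x - f'' x * (z - x)) (C := η * |y - x|) (x := x) (y := y)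
    (fun z hz => by
      have a1 := (hf' z hz.1).mono (inter_subset_left (t := Metric.closedBall x |y - x|))
      have a2 : HasDerivWithinAt (fun z => z - x) 1
          (Icc (-1 : ℝ) 1 ∩ Metric.closedBall x |y - x|) z :=
        (hasDerivWithinAt_id z _).sub_const x
      have a3 := (a1.sub (a2.const_mul (f' x))).sub ((a2.pow 2).const_mul (f'' x / 2))
      refine a3.congr_deriv ?_
      simp
      ring)
    (fun z hz => by
      have hz2 : |z - x| ≤ |y - x| := by
        have := hz.2
        rwa [Metric.mem_closedBall, Real.dist_eq] at this
      have := h1 (y := z) (by rw [Real.dist_eq]; exact lt_of_le_of_lt hz2 hyx) hz.1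
      simp only [smul_eq_mul, Real.norm_eq_abs] at this
      rw [Real.norm_eq_abs]
      calc _ = |f' z - f' x - (z - x) * f'' x| := by ring_nf
        _ ≤ _ := this
        _ ≤ _ := by gcongr)
    ⟨hx, by simp⟩ ⟨hy, by simp [Real.dist_eq]⟩
  simp only [Real.norm_eq_abs] at key
  calc _ = |f y - f' x * (y - x) - f'' x / 2 * (y - x) ^ 2
        - (f x - f' x * (x - x) - f'' x / 2 * (x - x) ^ 2)| := by ring_nf
    _ ≤ _ := key
    _ = _ := by rw [mul_assoc, ← sq, sq_abs]

lemma aux_sub (k : ℝ → ℝ) (hkeven : ∀ s, k (-s) = k s)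
    (hksupp : Function.support k ⊆ Icc (-1 : ℝ) 1) (x a b ε : ℝ) (hε : 0 < ε)
    (hab : Icc a b ⊆ Icc (-1 : ℝ) 1)
    (hT : ∀ s ∈ Icc (-1 : ℝ) 1, (x + ε * s ∈ Icc (-1 : ℝ) 1 ↔ s ∈ Icc a b)) (h : ℝ → ℝ) :
    ∫ y in Icc (-1 : ℝ) 1, h y * k (|x - y| / ε) = ε * ∫ s in Icc a b, h (x + ε * s) * k s := by
  have kabs : ∀ s, k |s| = k s := fun s => by
    rcases abs_choice s with h | h <;> rw [h]
    exact hkeven s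
  rw [← MeasureTheory.integral_indicator measurableSet_Icc, ← MeasureTheory.integral_indicator measurableSet_Icc]
  set G : ℝ → ℝ := (Icc (-1 : ℝ) 1).indicator fun y => h y * k (|x - y| / ε) with hG
  rw [← integral_add_left_eq_self G x]
  have := Measure.integral_comp_mul_left (fun y => G (x + y)) ε
  rw [abs_of_pos (inv_pos.2 hε), smul_eq_mul] at this
  have h2 : ∫ y, G (x + y) = ε * ∫ s, G (x + ε * s) := by
    rw [this]; field_simp
  rw [h2]
  congr 2
  ext s
  have e : |x - (x + ε * s)| / ε = |s| := by
    rw [sub_add_cancel_left, abs_neg, abs_mul, abs_of_pos hε]; field_simp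
  by_cases hs : s ∈ Icc (-1 : ℝ) 1
  · by_cases hs2 : s ∈ Icc a b
    · rw [hG, indicator_of_mem ((hT s hs).2 hs2), indicator_of_mem hs2, e, kabs]
    · rw [hG, indicator_of_notMem (fun h => hs2 ((hT s hs).1 h)), indicator_of_notMem hs2]
  · have k0 : k s = 0 := by
      by_contra h0
      exact hs (hksupp h0)
    rw [indicator_of_notMem (fun h => hs (hab h)), hG]
    by_cases h3 : x + ε * s ∈ Icc (-1 : ℝ) 1
    · rw [indicator_of_mem h3, e, kabs, k0, mul_zero]
    · rw [indicator_of_notMem h3]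

lemma aux_core (k : ℝ → ℝ) (hk0 : ∀ s, 0 ≤ k s) (hkeven : ∀ s, k (-s) = k s)
    (hksupp : Function.support k ⊆ Icc (-1 : ℝ) 1)
    (hkint : Integrable k volume) (M : ℝ)
    (f f' f'' : ℝ → ℝ)
    (hf' : ∀ x ∈ Icc (-1 : ℝ) 1, HasDerivWithinAt f (f' x) (Icc (-1 : ℝ) 1) x)
    (hf'' : ∀ x ∈ Icc (-1 : ℝ) 1, HasDerivWithinAt f' (f'' x) (Icc (-1 : ℝ) 1) x)
    (x : ℝ) (hx : x ∈ Icc (-1 : ℝ) 1) (a b : ℝ) (hab : Icc a b ⊆ Icc (-1 : ℝ) 1)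
    (hT : ∀ᶠ ε in 𝓝[>] (0 : ℝ), ∀ s ∈ Icc (-1 : ℝ) 1,
      (x + ε * s ∈ Icc (-1 : ℝ) 1 ↔ s ∈ Icc a b))
    (c : ℝ) (hc : 0 < c) (h0 : ∫ s in Icc a b, k s = c)
    (h1 : f' x * ∫ s in Icc a b, s * k s = 0)
    (h2 : ∫ s in Icc a b, s ^ 2 * k s = 2 * M * c) :
    Tendsto (fun ε : ℝ =>
          (ε ^ 2)⁻¹ * ∫ y in Icc (-1 : ℝ) 1,
            (f y - f x) * (k (|x - y| / ε) / ∫ z in Icc (-1 : ℝ) 1, k (|x - z| / ε)))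
        (𝓝[>] 0) (𝓝 (M * f'' x)) := by
  have hpos : ∀ᶠ ε in 𝓝[>] (0 : ℝ), 0 < ε := eventually_mem_nhdsWithin
  have hfc : ContinuousOn f (Icc (-1 : ℝ) 1) := fun y hy => (hf' y hy).continuousWithinAt
  set q : ℝ → ℝ → ℝ := fun ε s => (f (x + ε * s) - f x - f' x * (ε * s)) / ε ^ 2 with hq
  have hunif : ∀ η > 0, ∀ᶠ ε in 𝓝[>] (0 : ℝ), ∀ s ∈ Icc a b,
      |q ε s - f'' x / 2 * s ^ 2| ≤ η := by
    intro η hη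
    obtain ⟨δ, hδ, hP⟩ := aux_peano f f' f'' hf' hf'' x hx η hη
    have hlt : ∀ᶠ ε in 𝓝[>] (0 : ℝ), ε < δ :=
      eventually_nhdsWithin_of_eventually_nhds (eventually_lt_nhds hδ)
    filter_upwards [hT, hpos, hlt] with ε hTε hε hεδ s hs
    have hs1 := hab hs
    have hsabs : |s| ≤ 1 := abs_le.2 hs1
    have hss : s ^ 2 ≤ 1 := by rw [← sq_abs]; exact pow_le_one₀ (abs_nonneg _) hsabs
    have := hP (x + ε * s) ((hTε s hs1).2 hs) (by
      rw [add_sub_cancel_left, abs_mul, abs_of_pos hε]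
      nlinarith)
    rw [add_sub_cancel_left] at this
    have e : q ε s - f'' x / 2 * s ^ 2 = (f (x + ε * s) - f x - f' x * (ε * s)
        - f'' x / 2 * (ε * s) ^ 2) / ε ^ 2 := by
      simp only [hq]; field_simp
    rw [e, abs_div, abs_of_pos (by positivity : 0 < ε ^ 2), div_le_iff₀ (by positivity)]
    refine this.trans ?_
    rw [mul_pow]
    have : ε ^ 2 * s ^ 2 ≤ ε ^ 2 * 1 := by gcongr
    nlinarith
  have hfcomp : ∀ ε, (∀ s ∈ Icc (-1 : ℝ) 1, (x + ε * s ∈ Icc (-1 : ℝ) 1 ↔ s ∈ Icc a b)) →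
      ContinuousOn (fun s => f (x + ε * s)) (Icc a b) := fun ε hTε =>
    hfc.comp (by fun_prop) fun s hs => (hTε s (hab hs)).2 hs
  have hki : IntegrableOn k (Icc a b) := hkint.integrableOn
  have hlim : Tendsto (fun ε => ∫ s in Icc a b, q ε s * k s) (𝓝[>] 0)
      (𝓝 (∫ s in Icc a b, (f'' x / 2 * s ^ 2) * k s)) := by
    refine tendsto_integral_filter_of_dominated_convergence
      (fun s => (|f'' x / 2| + 1) * k s) ?_ ?_ (hki.const_mul _) ?_
    · filter_upwards [hT] with ε hTε
      refine AEStronglyMeasurable.mul ?_ hki.aestronglyMeasurable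
      refine ContinuousOn.aestronglyMeasurable ?_ measurableSet_Icc
      have := hfcomp ε hTε
      exact ((this.sub continuousOn_const).sub (by fun_prop)).div_const _
    · filter_upwards [hunif 1 one_pos] with ε hu
      filter_upwards [ae_restrict_mem measurableSet_Icc] with s hs
      rw [norm_mul, Real.norm_eq_abs, Real.norm_eq_abs, abs_of_nonneg (hk0 s)]
      refine mul_le_mul_of_nonneg_right ?_ (hk0 s)
      have hsabs : |s| ≤ 1 := abs_le.2 (hab hs)
      have hss : s ^ 2 ≤ 1 := by rw [← sq_abs]; exact pow_le_one₀ (abs_nonneg _) hsabs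
      have a1 : |f'' x / 2 * s ^ 2| ≤ |f'' x / 2| := by
        rw [abs_mul, abs_of_nonneg (sq_nonneg s)]
        exact mul_le_of_le_one_right (abs_nonneg _) hss
      have a2 := abs_sub_abs_le_abs_sub (q ε s) (f'' x / 2 * s ^ 2)
      linarith [hu s hs]
    · filter_upwards [ae_restrict_mem measurableSet_Icc] with s hs
      refine Tendsto.mul_const _ ?_
      rw [Metric.tendsto_nhds]
      intro η hη
      filter_upwards [hunif (η / 2) (by positivity)] with ε hu
      rw [Real.dist_eq]
      linarith [hu s hs]
  have hval : ∫ s in Icc a b, (f'' x / 2 * s ^ 2) * k s = c * (M * f'' x) := by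
    simp_rw [mul_assoc]
    rw [MeasureTheory.integral_const_mul, h2]; ring
  rw [hval] at hlim
  have hlim2 := hlim.const_mul c⁻¹
  rw [inv_mul_cancel_left₀ hc.ne'] at hlim2
  refine hlim2.congr' ?_
  filter_upwards [hT, hpos] with ε hTε hε
  have hD := aux_sub k hkeven hksupp x a b ε hε hab hTε (fun _ => 1)
  simp only [one_mul] at hD
  rw [hD, h0]
  have hN := aux_sub k hkeven hksupp x a b ε hε hab hTε (fun y => f y - f x)
  simp_rw [← mul_div_assoc]
  rw [MeasureTheory.integral_div, hN]
  have i1 : IntegrableOn (fun s => (f (x + ε * s) - f x) * k s) (Icc a b) :=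
    hki.continuousOn_mul ((hfcomp ε hTε).sub continuousOn_const) isCompact_Icc
  have i2 : IntegrableOn (fun s => s * k s) (Icc a b) :=
    hki.continuousOn_mul (by fun_prop) isCompact_Icc
  have e : ∀ s, q ε s * k s = (ε ^ 2)⁻¹ * ((f (x + ε * s) - f x) * k s - (f' x * ε) * (s * k s)) := by
    intro s
    simp only [hq]; field_simp
  simp_rw [e]
  rw [MeasureTheory.integral_const_mul, MeasureTheory.integral_sub i1 (i2.const_mul _), MeasureTheory.integral_const_mul]
  have : f' x * ε * ∫ s in Icc a b, s * k s = 0 := by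
    rw [mul_right_comm, h1, zero_mul]
  rw [this]
  field_simp
  ring

lemma aux_flip (g : ℝ → ℝ) : ∫ s in Icc (-1 : ℝ) 0, g s = ∫ s in Icc (0 : ℝ) 1, g (-s) := by
  rw [integral_Icc_eq_integral_Ioc, integral_Icc_eq_integral_Ioc,
    ← intervalIntegral.integral_of_le (by norm_num), ← intervalIntegral.integral_of_le (by norm_num)]
  simp

lemma aux_split (g : ℝ → ℝ) (hg : IntegrableOn g (Icc (-1 : ℝ) 1)) :
    ∫ s in Icc (-1 : ℝ) 1, g s = (∫ s in Icc (-1 : ℝ) 0, g s) + ∫ s in Icc (0 : ℝ) 1, g s := by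
  have h1 : IntervalIntegrable g volume (-1) 0 :=
    (intervalIntegrable_iff_integrableOn_Icc_of_le (by norm_num)).2
      (hg.mono_set (Icc_subset_Icc le_rfl (by norm_num)))
  have h2 : IntervalIntegrable g volume 0 1 :=
    (intervalIntegrable_iff_integrableOn_Icc_of_le (by norm_num)).2
      (hg.mono_set (Icc_subset_Icc (by norm_num) le_rfl))
  simp only [integral_Icc_eq_integral_Ioc]
  rw [← intervalIntegral.integral_of_le (by norm_num), ← intervalIntegral.integral_of_le (by norm_num),
    ← intervalIntegral.integral_of_le (by norm_num)]
  exact (intervalIntegral.integral_add_adjacent_intervals h1 h2).symm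

/-- Kernel averaging Laplacian on `[-1,1]`: for an even nonnegative integrable profile `k`
supported in `[-1,1]` with unit integral and half second moment `M`, and `f` with continuous
second derivative, `ε⁻² 𝓛_{K,ε} f(x) → M f''(x)` at interior points, and also at `±1`
when `f'(±1) = 0`. -/
theorem stmt5
    (k : ℝ → ℝ) (hk0 : ∀ s, 0 ≤ k s) (hkeven : ∀ s, k (-s) = k s)
    (hksupp : Function.support k ⊆ Icc (-1 : ℝ) 1)
    (hkint : Integrable k volume) (hknorm : ∫ s, k s = 1)
    (M : ℝ) (hM : M = (1 / 2) * ∫ y in (-1 : ℝ)..1, k y * y ^ 2)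
    (f f' f'' : ℝ → ℝ)
    (hf' : ∀ x ∈ Icc (-1 : ℝ) 1, HasDerivWithinAt f (f' x) (Icc (-1 : ℝ) 1) x)
    (hf'' : ∀ x ∈ Icc (-1 : ℝ) 1, HasDerivWithinAt f' (f'' x) (Icc (-1 : ℝ) 1) x)
    (hf''cont : ContinuousOn f'' (Icc (-1 : ℝ) 1)) :
    (∀ x ∈ Ioo (-1 : ℝ) 1,
      Tendsto (fun ε : ℝ =>
          (ε ^ 2)⁻¹ * ∫ y in Icc (-1 : ℝ) 1,
            (f y - f x) * (k (|x - y| / ε) / ∫ z in Icc (-1 : ℝ) 1, k (|x - z| / ε)))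
        (𝓝[>] 0) (𝓝 (M * f'' x))) ∧
    (f' (-1) = 0 → f' 1 = 0 → ∀ x ∈ ({-1, 1} : Set ℝ),
      Tendsto (fun ε : ℝ =>
          (ε ^ 2)⁻¹ * ∫ y in Icc (-1 : ℝ) 1,
            (f y - f x) * (k (|x - y| / ε) / ∫ z in Icc (-1 : ℝ) 1, k (|x - z| / ε)))
        (𝓝[>] 0) (𝓝 (M * f'' x))) := by
  have hki : IntegrableOn k (Icc (-1 : ℝ) 1) := hkint.integrableOn
  have i1 : IntegrableOn (fun s => s * k s) (Icc (-1 : ℝ) 1) :=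
    hki.continuousOn_mul (by fun_prop) isCompact_Icc
  have i2 : IntegrableOn (fun s => s ^ 2 * k s) (Icc (-1 : ℝ) 1) :=
    hki.continuousOn_mul (by fun_prop) isCompact_Icc
  have t0 : ∫ s in Icc (-1 : ℝ) 1, k s = 1 := by
    rw [setIntegral_eq_integral_of_forall_compl_eq_zero, hknorm]
    intro s hs
    by_contra h0
    exact hs (hksupp h0)
  have t2 : ∫ s in Icc (-1 : ℝ) 1, s ^ 2 * k s = 2 * M := by
    rw [hM, intervalIntegral.integral_of_le (by norm_num), ← integral_Icc_eq_integral_Ioc]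
    simp_rw [mul_comm (k _)]
    ring
  have f0 := aux_flip k
  have f1 := aux_flip (fun s => s * k s)
  have f2 := aux_flip (fun s => s ^ 2 * k s)
  have s0 := aux_split k hki
  have s1 := aux_split _ i1
  have s2 := aux_split _ i2
  simp only [hkeven, neg_sq, neg_mul, MeasureTheory.integral_neg] at f0 f1 f2
  have hpos : ∀ᶠ ε in 𝓝[>] (0 : ℝ), 0 < ε := eventually_mem_nhdsWithin
  have hlt : ∀ d > (0 : ℝ), ∀ᶠ ε in 𝓝[>] (0 : ℝ), ε < d := fun d hd =>
    eventually_nhdsWithin_of_eventually_nhds (eventually_lt_nhds hd)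
  refine ⟨fun x hx => ?_, fun hl hr x hx => ?_⟩
  · refine aux_core k hk0 hkeven hksupp hkint M f f' f'' hf' hf'' x (Ioo_subset_Icc_self hx)
      (-1) 1 subset_rfl ?_ 1 one_pos t0 (by rw [s1, f1]; ring) (by rw [t2]; ring)
    filter_upwards [hpos, hlt (x + 1) (by linarith [hx.1]), hlt (1 - x) (by linarith [hx.2])]
      with ε h0 h1 h2 s hs
    refine ⟨fun _ => hs, fun _ => ⟨?_, ?_⟩⟩ <;> nlinarith [hs.1, hs.2]
  · rcases hx with rfl | hx
    · refine aux_core k hk0 hkeven hksupp hkint M f f' f'' hf' hf'' (-1) (by norm_num)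
        0 1 (Icc_subset_Icc (by norm_num) le_rfl) ?_ (1 / 2) (by norm_num) (by linarith)
        (by rw [hl, zero_mul]) (by linarith)
      filter_upwards [hpos, hlt 1 one_pos] with ε h0 h1 s hs
      refine ⟨fun h => ⟨?_, hs.2⟩, fun h => ⟨?_, ?_⟩⟩
      · by_contra hneg
        nlinarith [h.1]
      · nlinarith [h.1]
      · nlinarith [h.1, h.2]
    · rw [mem_singleton_iff] at hx
      subst hx
      refine aux_core k hk0 hkeven hksupp hkint M f f' f'' hf' hf'' 1 (by norm_num)
        (-1) 0 (Icc_subset_Icc le_rfl (by norm_num)) ?_ (1 / 2) (by norm_num) (by linarith)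
        (by rw [hr, zero_mul]) (by linarith)
      filter_upwards [hpos, hlt 1 one_pos] with ε h0 h1 s hs
      refine ⟨fun h => ⟨hs.1, ?_⟩, fun h => ⟨?_, ?_⟩⟩
      · by_contra hneg
        nlinarith [h.2]
      · nlinarith [h.1, h.2]
      · nlinarith [h.2]
end

section
/- There is an absolute constant C (one may take C = π⁴/96) such that for all integers n ≥ 2 and all integers k with 1 ≤ k ≤ k₀ ≤ n−1, |(1/2)((1/2) k π)² − (1/4)(n−1)² (1 − cos(kπ/(n−1)))| ≤ C k₀⁴ (n−1)⁻². Consequently, if f is an eigenfunction of the Neumann Laplacian 𝓛 = (1/2) d²/dx² on [−1,1] associated to one of its first k₀ nonzero eigenvalues (equivalently, an eigenfunction of the graph Laplacian 𝓛_{2/(n−1),n} on Sₙ), then |𝓛 f(xⱼ) − (1/4)(n−1)² 𝓛_{2/(n−1),n} f(xⱼ)| ≤ C k₀⁴ (n−1)⁻² · |f(xⱼ)| at every point xⱼ of Sₙ. -/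
theorem aux_cos_upper (t : ℝ) : Real.cos t ≤ 1 - t ^ 2 / 2 + t ^ 4 / 24 := by
  have main : ∀ s : ℝ, 0 ≤ s → s ^ 2 - s ^ 4 / 3 ≤ Real.sin s ^ 2 := by
    intro s hs
    rcases le_total (s ^ 2) 6 with h | h
    · have h1 : s - s ^ 3 / 6 ≤ Real.sin s := Real.sin_ge_sub_cube hs
      have h0 : 0 ≤ s - s ^ 3 / 6 := by
        have : 0 ≤ s * (6 - s ^ 2) := mul_nonneg hs (by linarith)
        nlinarith
      have h2 := pow_le_pow_left₀ h0 h1 2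
      have h3 : 0 ≤ (s ^ 3) ^ 2 := sq_nonneg _
      nlinarith
    · have h3 := sq_nonneg (Real.sin s)
      nlinarith
  have h := main (|t| / 2) (by positivity)
  have hc : Real.cos t = 1 - 2 * Real.sin (|t| / 2) ^ 2 := by
    rw [← Real.cos_abs t]
    have h1 := Real.cos_two_mul (|t| / 2)
    have h2 := Real.sin_sq_add_cos_sq (|t| / 2)
    rw [mul_div_cancel₀ _ (two_ne_zero)] at h1
    linarith
  have e2 : |t| ^ 2 = t ^ 2 := sq_abs t
  have e4 : |t| ^ 4 = t ^ 4 := by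
    calc |t| ^ 4 = (|t| ^ 2) ^ 2 := by ring
      _ = t ^ 4 := by rw [e2]; ring
  rw [div_pow, div_pow, e2, e4] at h
  rw [hc]
  linarith

theorem aux_deriv2_cos (a x : ℝ) :
    deriv (deriv (fun x : ℝ => Real.cos (a * x / 2))) x = -(a / 2) ^ 2 * Real.cos (a * x / 2) := by
  have hl : ∀ y : ℝ, HasDerivAt (fun x : ℝ => a * x / 2) (a / 2) y := fun y => by
    simpa using ((hasDerivAt_id y).const_mul a).div_const 2
  have h1 : deriv (fun x : ℝ => Real.cos (a * x / 2)) =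
      fun x => -Real.sin (a * x / 2) * (a / 2) := by
    funext y
    exact (hl y).cos.deriv
  rw [h1]
  have h2 : HasDerivAt (fun x => -Real.sin (a * x / 2) * (a / 2))
      (-(Real.cos (a * x / 2) * (a / 2)) * (a / 2)) x := ((hl x).sin.neg).mul_const (a / 2)
  rw [h2.deriv]
  ring

theorem aux_deriv2_sin (a x : ℝ) :
    deriv (deriv (fun x : ℝ => Real.sin (a * x / 2))) x = -(a / 2) ^ 2 * Real.sin (a * x / 2) := by
  have hl : ∀ y : ℝ, HasDerivAt (fun x : ℝ => a * x / 2) (a / 2) y := fun y => by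
    simpa using ((hasDerivAt_id y).const_mul a).div_const 2
  have h1 : deriv (fun x : ℝ => Real.sin (a * x / 2)) =
      fun x => Real.cos (a * x / 2) * (a / 2) := by
    funext y
    exact (hl y).sin.deriv
  rw [h1, (((hl x).cos).mul_const (a / 2)).deriv]
  ring

/-- Comparison of the `k`-th Neumann eigenvalue of `(1/2) d²/dx²` on `[-1,1]` with the
`k`-th eigenvalue of the rescaled graph Laplacian on `n` equally spaced points, with
constant `C = π⁴/96`, and the resulting pointwise comparison of `𝓛 f` with
`(1/4)(n-1)² 𝓛_{2/(n-1),n} f` for the common eigenfunctions. -/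
theorem stmt9 (n : ℕ) (hn : 2 ≤ n) (k k₀ : ℕ) (hk1 : 1 ≤ k) (hkk₀ : k ≤ k₀)
    (hk₀ : k₀ ≤ n - 1) :
    |(1 / 2 : ℝ) * ((1 / 2) * k * Real.pi) ^ 2 -
        (1 / 4) * ((n : ℝ) - 1) ^ 2 * (1 - Real.cos (k * Real.pi / ((n : ℝ) - 1)))| ≤
      (Real.pi ^ 4 / 96) * (k₀ : ℝ) ^ 4 / ((n : ℝ) - 1) ^ 2 ∧
    (let pt : ℕ → ℝ := fun j => -1 + 2 * ((j : ℝ) - 1) / ((n : ℝ) - 1)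
     let φ : ℝ → ℝ := fun x => if Even k then Real.cos (k * Real.pi * x / 2)
                               else Real.sin (k * Real.pi * x / 2)
     ∀ j : ℕ, 1 ≤ j → j ≤ n →
       |(1 / 2) * deriv (deriv φ) (pt j) -
           (1 / 4) * ((n : ℝ) - 1) ^ 2 *
             (if j = 1 then φ (pt 2) - φ (pt 1)
              else if j = n then φ (pt (n - 1)) - φ (pt n)
              else (φ (pt (j + 1)) + φ (pt (j - 1)) - 2 * φ (pt j)) / 2)| ≤
         (Real.pi ^ 4 / 96) * (k₀ : ℝ) ^ 4 / ((n : ℝ) - 1) ^ 2 * |φ (pt j)|) := by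
  have hm : (1 : ℝ) ≤ (n : ℝ) - 1 := by
    have : (2 : ℝ) ≤ n := by exact_mod_cast hn
    linarith
  have hm0 : (n : ℝ) - 1 ≠ 0 := by linarith
  have key : |(1 / 2 : ℝ) * ((1 / 2) * k * Real.pi) ^ 2 -
        (1 / 4) * ((n : ℝ) - 1) ^ 2 * (1 - Real.cos (k * Real.pi / ((n : ℝ) - 1)))| ≤
      (Real.pi ^ 4 / 96) * (k₀ : ℝ) ^ 4 / ((n : ℝ) - 1) ^ 2 := by
    generalize (n : ℝ) - 1 = m at hm hm0
    have hk : (k : ℝ) ≤ k₀ := by exact_mod_cast hkk₀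
    have e1 : (1 / 2 : ℝ) * ((1 / 2) * k * Real.pi) ^ 2 =
        (1 / 4) * m ^ 2 * ((k * Real.pi / m) ^ 2 / 2) := by
      field_simp
      try ring
    have e2 : (1 / 4) * m ^ 2 * ((k * Real.pi / m) ^ 4 / 24) =
        (Real.pi ^ 4 / 96) * (k : ℝ) ^ 4 / m ^ 2 := by
      field_simp
      try ring
    have e3 : (Real.pi ^ 4 / 96) * (k : ℝ) ^ 4 / m ^ 2 ≤
        (Real.pi ^ 4 / 96) * (k₀ : ℝ) ^ 4 / m ^ 2 := by gcongr
    have hlo := Real.one_sub_sq_div_two_le_cos (x := k * Real.pi / m)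
    have hhi := aux_cos_upper (k * Real.pi / m)
    rw [e1, ← mul_sub, abs_of_nonneg (mul_nonneg (by positivity) (by linarith))]
    refine le_trans ?_ e3
    rw [← e2]
    apply mul_le_mul_of_nonneg_left _ (by positivity)
    linarith
  refine ⟨key, ?_⟩
  intro pt φ j hj1 hjn
  have hD : deriv (deriv φ) (pt j) = -(k * Real.pi / 2) ^ 2 * φ (pt j) := by
    by_cases he : Even k
    · have : φ = fun x => Real.cos (k * Real.pi * x / 2) := by
        funext x; simp [φ, he]
      rw [this]; exact aux_deriv2_cos _ _
    · have : φ = fun x => Real.sin (k * Real.pi * x / 2) := by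
        funext x; simp [φ, he]
      rw [this]; exact aux_deriv2_sin _ _
  set t : ℝ := k * Real.pi / ((n : ℝ) - 1) with ht
  have hadd : ∀ i : ℕ, k * Real.pi * pt (i + 1) / 2 = k * Real.pi * pt i / 2 + t := by
    intro i
    simp only [pt, ht]
    push_cast
    field_simp
    ring
  have hG : (if j = 1 then φ (pt 2) - φ (pt 1)
              else if j = n then φ (pt (n - 1)) - φ (pt n)
              else (φ (pt (j + 1)) + φ (pt (j - 1)) - 2 * φ (pt j)) / 2) =
      -(1 - Real.cos t) * φ (pt j) := by
    have hp1 : pt 1 = -1 := by simp [pt]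
    have hpn : pt n = 1 := by
      simp only [pt]
      field_simp
      ring
    have hs : ∀ x : ℝ, (x = 1 ∨ x = -1) → (if Even k then Real.sin (k * Real.pi * x / 2) = 0
        else Real.cos (k * Real.pi * x / 2) = 0) := by
      intro x hx
      split_ifs with he
      · obtain ⟨r, rfl⟩ := he
        have : Real.sin (r * Real.pi) = 0 := Real.sin_nat_mul_pi r
        rcases hx with rfl | rfl
        · rw [← this]; congr 1; push_cast; ring
        · rw [← neg_eq_zero, ← Real.sin_neg, ← this]; congr 1; push_cast; ring
      · obtain ⟨r, rfl⟩ := Nat.not_even_iff_odd.mp he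
        have : Real.cos (r * Real.pi + Real.pi / 2) = 0 := by
          rw [Real.cos_add_pi_div_two, Real.sin_nat_mul_pi, neg_zero]
        rcases hx with rfl | rfl
        · rw [← this]; congr 1; push_cast; ring
        · rw [← Real.cos_neg, ← this]; congr 1; push_cast; ring
    split_ifs with h1 h2
    · subst h1
      have h := hs (pt 1) (Or.inr hp1)
      have h12 := hadd 1
      norm_num only at h12
      simp only [φ]
      rw [h12]
      split_ifs at h ⊢
      · rw [Real.cos_add, h]; ring
      · rw [Real.sin_add, h]; ring
    · subst h2
      have h := hs (pt j) (Or.inl hpn)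
      have h12 := hadd (j - 1)
      rw [Nat.sub_add_cancel hj1] at h12
      have h13 : k * Real.pi * pt (j - 1) / 2 = k * Real.pi * pt j / 2 - t := by linarith
      simp only [φ]
      rw [h13]
      split_ifs at h ⊢
      · rw [Real.cos_sub, h]; ring
      · rw [Real.sin_sub, h]; ring
    · have h12 := hadd (j - 1)
      rw [Nat.sub_add_cancel hj1] at h12
      have h13 : k * Real.pi * pt (j - 1) / 2 = k * Real.pi * pt j / 2 - t := by linarith
      simp only [φ]
      rw [h13, hadd j]
      split_ifs
      · rw [Real.cos_sub, Real.cos_add]; ring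
      · rw [Real.sin_sub, Real.sin_add]; ring
  rw [hG, hD]
  have : (1 / 2) * (-(k * Real.pi / 2) ^ 2 * φ (pt j)) -
      (1 / 4) * ((n : ℝ) - 1) ^ 2 * (-(1 - Real.cos t) * φ (pt j)) =
      -((1 / 2 : ℝ) * ((1 / 2) * k * Real.pi) ^ 2 -
        (1 / 4) * ((n : ℝ) - 1) ^ 2 * (1 - Real.cos t)) * φ (pt j) := by ring
  rw [this, abs_mul, abs_neg]
  exact mul_le_mul_of_nonneg_right key (abs_nonneg _)
end
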